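/- (EPR pair, second partial measurement.) For θ, φ : ℝ, let u(θ,φ) = cos θ • e₀ + (sin θ · exp(i·φ)) • e₁ and v(θ,φ) = (−sin θ) • e₀ + (cos θ · exp(i·φ)) • e₁ in EuclideanSpace ℂ (Fin 2), and let Ψ⁻ = (1/√2)·(e₀ ⊗ e₁ − e₁ ⊗ e₀) in EuclideanSpace ℂ (Fin 2 × Fin 2). Then appl₂(v(θ,φ), Ψ⁻) = (exp(−i·φ)/√2) • u(θ,φ); in particular appl₂(v(θ,φ), Ψ⁻) is a nonzero scalar multiple of u(θ,φ). -/

import Mathlib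

/-- The standard basis of `ℂ² = EuclideanSpace ℂ (Fin 2)`. -/
noncomputable def e (i : Fin 2) : EuclideanSpace ℂ (Fin 2) :=
  EuclideanSpace.single i 1

/-- Tensor product: `(f ⊗ g)(i, j) = f i * g j`. -/
noncomputable def tp (f g : EuclideanSpace ℂ (Fin 2)) :
    EuclideanSpace ℂ (Fin 2 × Fin 2) :=
  WithLp.toLp 2 fun p => f p.1 * g p.2

/-- Partial application at place 2: `appl₂(χ, ψ)(i) = ∑ j, ψ (i, j) * conj (χ j)`. -/
noncomputable def appl2 (χ : EuclideanSpace ℂ (Fin 2))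
    (ψ : EuclideanSpace ℂ (Fin 2 × Fin 2)) : EuclideanSpace ℂ (Fin 2) :=
  WithLp.toLp 2 fun i => ∑ j, ψ (i, j) * (starRingEnd ℂ) (χ j)

/-- `u(θ,φ) = cos θ • e₀ + (sin θ · e^{iφ}) • e₁`. -/
noncomputable def u (θ φ : ℝ) : EuclideanSpace ℂ (Fin 2) :=
  (Real.cos θ : ℂ) • e 0 + ((Real.sin θ : ℂ) * Complex.exp (Complex.I * φ)) • e 1

/-- `v(θ,φ) = (−sin θ) • e₀ + (cos θ · e^{iφ}) • e₁`. -/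
noncomputable def v (θ φ : ℝ) : EuclideanSpace ℂ (Fin 2) :=
  (-(Real.sin θ) : ℂ) • e 0 + ((Real.cos θ : ℂ) * Complex.exp (Complex.I * φ)) • e 1

/-- The singlet state `Ψ⁻ = (1/√2)·(e₀ ⊗ e₁ − e₁ ⊗ e₀)`. -/
noncomputable def PsiMinus : EuclideanSpace ℂ (Fin 2 × Fin 2) :=
  ((1 / Real.sqrt 2 : ℝ) : ℂ) • (tp (e 0) (e 1) - tp (e 1) (e 0))

/-- EPR pair, second partial measurement:
`appl₂(v(θ,φ), Ψ⁻) = (e^{−iφ}/√2) • u(θ,φ)`; in particular it is a nonzero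
scalar multiple of `u(θ,φ)`. -/
theorem epr_second_partial_measurement (θ φ : ℝ) :
    appl2 (v θ φ) PsiMinus =
      (Complex.exp (-(Complex.I * φ)) / Real.sqrt 2) • u θ φ ∧
    ∃ c : ℂ, c ≠ 0 ∧ appl2 (v θ φ) PsiMinus = c • u θ φ := by
  have hE : Complex.exp (-(Complex.I * φ)) * Complex.exp (Complex.I * φ) = 1 := by
    rw [← Complex.exp_add]; simp
  have hc : (starRingEnd ℂ) (Complex.exp (Complex.I * φ)) = Complex.exp (-(Complex.I * φ)) := by
    rw [← Complex.exp_conj]; simp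
  have h : appl2 (v θ φ) PsiMinus =
      (Complex.exp (-(Complex.I * φ)) / Real.sqrt 2) • u θ φ := by
    ext i
    fin_cases i
    · simp [appl2, v, u, PsiMinus, tp, e, hc, -Complex.ofReal_cos, -Complex.ofReal_sin,
        Complex.conj_ofReal]
      ring
    · simp [appl2, v, u, PsiMinus, tp, e, hc, -Complex.ofReal_cos, -Complex.ofReal_sin,
        Complex.conj_ofReal]
      linear_combination (-(Real.sin θ : ℂ) / (Real.sqrt 2 : ℂ)) * hE
  refine ⟨h, _, ?_, h⟩
  apply div_ne_zero (Complex.exp_ne_zero _)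
  simp
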